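/- Let κ, μ, r̂ > 0 and r > 0. For m_t > 1 let v(r; m_t) = (2(1+κ)^μ μ^μ e^{−κμ} ((m_t−1)r̂²)^{m_t} r^{2μ−1} / (B(m_t,μ)(r̂²(m_t−1) + r²(1+κ)μ)^{m_t+μ})) ₁F₁(m_t+μ; μ; μ²κ(1+κ)r² / (r̂²(m_t−1) + r²(1+κ)μ)) denote the single shadowed κ-μ Type III (inverse Nakagami-m) PDF. Then lim_{m_t → ∞} v(r; m_t) = 2μ(1+κ)^{(μ+1)/2} r^μ κ^{−(μ−1)/2} e^{−κμ} r̂^{−(μ+1)} e^{−μ(1+κ)r²/r̂²} I_{μ−1}(2μ√(κ(1+κ)) r/r̂), i.e., the single shadowed κ-μ Type III (inverse Nakagami-m) PDF converges pointwise to the κ-μ PDF as the multiplicative shadowing parameter tends to infinity. -/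

import Mathlib

open MeasureTheory Set

/-- Pochhammer (rising factorial) symbol `(a)_n = Γ(a+n)/Γ(a)`. -/
noncomputable def poch (a : ℝ) (n : ℕ) : ℝ := Real.Gamma (a + n) / Real.Gamma a

/-- Beta function `B(x,y) = Γ(x)Γ(y)/Γ(x+y)`. -/
noncomputable def betaFn (x y : ℝ) : ℝ := Real.Gamma x * Real.Gamma y / Real.Gamma (x + y)

/-- Modified Bessel function of the first kind of real order ν. -/
noncomputable def besselI (ν x : ℝ) : ℝ :=
  ∑' k : ℕ, (x / 2) ^ (ν + 2 * (k : ℝ)) / ((k.factorial : ℝ) * Real.Gamma (ν + (k : ℝ) + 1))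

/-- Modified Bessel function of the second kind of real order ν. -/
noncomputable def besselK (ν x : ℝ) : ℝ :=
  ∫ t in Ioi (0 : ℝ), Real.exp (-x * Real.cosh t) * Real.cosh (ν * t)

/-- Confluent hypergeometric function ₁F₁(a;b;z). -/
noncomputable def hyp1F1 (a b z : ℝ) : ℝ :=
  ∑' n : ℕ, poch a n * z ^ n / (poch b n * (n.factorial : ℝ))

/-- Gauss hypergeometric function ₂F₁(a,b;c;z). -/
noncomputable def hyp2F1 (a b c z : ℝ) : ℝ :=
  ∑' n : ℕ, poch a n * poch b n * z ^ n / (poch c n * (n.factorial : ℝ))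

/-- Tricomi confluent hypergeometric function U(a,b,z). -/
noncomputable def tricomiU (a b z : ℝ) : ℝ :=
  (1 / Real.Gamma a) *
    ∫ t in Ioi (0 : ℝ), Real.exp (-z * t) * t ^ (a - 1) * (1 + t) ^ (b - a - 1)

/-- Regularized generalized hypergeometric function ₃F̃₁(a₁,a₂,a₃;b;z). -/
noncomputable def hyp3F1reg (a₁ a₂ a₃ b z : ℝ) : ℝ :=
  ∑' n : ℕ, poch a₁ n * poch a₂ n * poch a₃ n * z ^ n /
    (Real.Gamma (b + n) * (n.factorial : ℝ))

/-- Regularized generalized hypergeometric function ₂F̃₂(a,b;c,d;z). -/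
noncomputable def hyp2F2reg (a b c d z : ℝ) : ℝ :=
  ∑' n : ℕ, poch a n * poch b n * z ^ n /
    (Real.Gamma (c + n) * Real.Gamma (d + n) * (n.factorial : ℝ))

open Filter Topology

theorem poch_zero {a : ℝ} (ha : 0 < a) : poch a 0 = 1 := by
  simp [poch, (Real.Gamma_pos_of_pos ha).ne']

theorem poch_succ {a : ℝ} (ha : 0 < a) (n : ℕ) : poch a (n + 1) = poch a n * (a + n) := by
  have hn : a + n ≠ 0 := by positivity
  rw [poch, poch, Nat.cast_succ, ← add_assoc, Real.Gamma_add_one hn]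
  ring

theorem poch_pos {a : ℝ} (ha : 0 < a) (n : ℕ) : 0 < poch a n :=
  div_pos (Real.Gamma_pos_of_pos (by positivity)) (Real.Gamma_pos_of_pos ha)

theorem poch_le_pow_mul_factorial {a : ℝ} (ha : 1 ≤ a) (n : ℕ) :
    poch a n ≤ a ^ n * n.factorial := by
  have ha' : 0 < a := by linarith
  induction n with
  | zero => simp [poch_zero ha']
  | succ n ih =>
    have h : a + n ≤ a * (n + 1) := by nlinarith [(n.cast_nonneg : (0 : ℝ) ≤ n)]
    calc poch a (n + 1) = poch a n * (a + n) := poch_succ ha' n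
      _ ≤ (a ^ n * n.factorial) * (a * (n + 1)) := by gcongr
      _ = a ^ (n + 1) * (n + 1).factorial := by
        rw [Nat.factorial_succ]; push_cast; ring

theorem summable_pow_div_poch {b K : ℝ} (hb : 0 < b) (hK : 0 < K) :
    Summable fun n : ℕ => K ^ n / poch b n := by
  refine summable_of_ratio_test_tendsto_lt_one (l := 0) zero_lt_one
    (Eventually.of_forall fun n => (div_pos (pow_pos hK n) (poch_pos hb n)).ne') ?_
  have h : Tendsto (fun n : ℕ => K / (b + n)) atTop (𝓝 0) :=
    (tendsto_atTop_add_const_left _ b tendsto_natCast_atTop_atTop).const_div_atTop K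
  refine h.congr fun n => ?_
  have hn : 0 < b + n := by positivity
  have hp := poch_pos hb n
  rw [Real.norm_of_nonneg (div_pos (pow_pos hK _) (poch_pos hb _)).le,
    Real.norm_of_nonneg (div_pos (pow_pos hK _) hp).le, poch_succ hb, pow_succ]
  field_simp

/-- Confluence `₁F₁(a; b; z) → ₀F₁(; b; c)` as `a → ∞` with `a z → c`. -/
theorem tendsto_hyp1F1_of_tendsto_mul {ι : Type*} {l : Filter ι} {a z : ι → ℝ} {b c : ℝ}
    (hb : 0 < b) (ha : Tendsto a l atTop) (hz : ∀ᶠ x in l, 0 ≤ z x)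
    (hz0 : Tendsto z l (𝓝 0)) (haz : Tendsto (fun x => a x * z x) l (𝓝 c)) (hc : 0 < c) :
    Tendsto (fun x => hyp1F1 (a x) b (z x)) l
      (𝓝 (∑' n : ℕ, c ^ n / (poch b n * n.factorial))) := by
  refine tendsto_tsum_of_dominated_convergence
    (summable_pow_div_poch hb (by positivity : 0 < c + 1)) (fun n => ?_) ?_
  · refine Tendsto.div_const ?_ _
    induction n with
    | zero =>
      refine tendsto_const_nhds.congr' ?_
      filter_upwards [ha.eventually_gt_atTop 0] with x hx
      simp [poch_zero hx]
    | succ n ih =>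
      have h : Tendsto (fun x => a x * z x + n * z x) l (𝓝 (c + n * 0)) :=
        haz.add (hz0.const_mul _)
      rw [mul_zero, add_zero] at h
      rw [pow_succ]
      refine (ih.mul h).congr' ?_
      filter_upwards [ha.eventually_gt_atTop 0] with x hx
      rw [poch_succ hx]
      ring
  · filter_upwards [ha.eventually_ge_atTop 1, hz, haz.eventually_le_const (lt_add_one c)]
      with x hx hzx hazx n
    have hp := poch_pos hb n
    have hpa := poch_pos (zero_lt_one.trans_le hx) n
    rw [Real.norm_of_nonneg (by positivity)]
    calc poch (a x) n * z x ^ n / (poch b n * n.factorial)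
        ≤ (a x ^ n * n.factorial) * z x ^ n / (poch b n * n.factorial) := by
          gcongr
          exact poch_le_pow_mul_factorial hx n
      _ = (a x * z x) ^ n / poch b n := by
          rw [mul_pow]
          field_simp
      _ ≤ (c + 1) ^ n / poch b n := by
          have : 0 ≤ a x * z x := by positivity
          gcongr

theorem Gamma_add_le_rpow_mul_Gamma {x s : ℝ} (hx : 0 < x) (hs : 0 ≤ s) (hs1 : s ≤ 1) :
    Real.Gamma (x + s) ≤ x ^ s * Real.Gamma x := by
  rcases hs.eq_or_lt with rfl | hs
  · simp
  rcases hs1.eq_or_lt with rfl | hs1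
  · rw [Real.Gamma_add_one hx.ne', Real.rpow_one]
  have h := Real.Gamma_mul_add_mul_le_rpow_Gamma_mul_rpow_Gamma hx (by linarith : 0 < x + 1)
    (sub_pos.2 hs1) hs (by ring)
  have hG := Real.Gamma_pos_of_pos hx
  rw [Real.Gamma_add_one hx.ne', Real.mul_rpow hx.le hG.le] at h
  calc Real.Gamma (x + s) = Real.Gamma ((1 - s) * x + s * (x + 1)) := by ring_nf
    _ ≤ _ := h
    _ = x ^ s * (Real.Gamma x ^ (1 - s) * Real.Gamma x ^ s) := by ring
    _ = _ := by rw [← Real.rpow_add hG]; simp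

theorem tendsto_Gamma_add_div_of_le_one {s : ℝ} (hs : 0 ≤ s) (hs1 : s ≤ 1) :
    Tendsto (fun x : ℝ => Real.Gamma (x + s) / (Real.Gamma x * x ^ s)) atTop (𝓝 1) := by
  have h : Tendsto (fun x : ℝ => (1 + s / x) ^ (s - 1)) atTop (𝓝 1) := by
    have h1 : Tendsto (fun x : ℝ => 1 + s / x) atTop (𝓝 (1 + 0)) :=
      tendsto_const_nhds.add (tendsto_id.const_div_atTop s)
    simpa using h1.rpow_const (p := s - 1) (by simp)
  refine tendsto_of_tendsto_of_tendsto_of_le_of_le' h tendsto_const_nhds ?_ ?_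
  · filter_upwards [eventually_gt_atTop 0] with x hx
    have hG := Real.Gamma_pos_of_pos hx
    have hxs : 0 < x + s := by positivity
    have h := Gamma_add_le_rpow_mul_Gamma hxs (sub_nonneg.2 hs1) (by linarith : 1 - s ≤ 1)
    rw [add_add_sub_cancel, Real.Gamma_add_one hx.ne'] at h
    rw [le_div_iff₀ (by positivity), one_add_div hx.ne', Real.div_rpow hxs.le hx.le,
      ← neg_sub 1 s, Real.rpow_neg hxs.le, Real.rpow_neg hx.le]
    have e : x ^ (1 - s) * x ^ s = x := by rw [← Real.rpow_add hx]; simp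
    have hp : 0 < (x + s) ^ (1 - s) := by positivity
    rw [div_inv_eq_mul, inv_mul_eq_div, div_mul_eq_mul_div, div_le_iff₀ hp]
    calc x ^ (1 - s) * (Real.Gamma x * x ^ s) = (x ^ (1 - s) * x ^ s) * Real.Gamma x := by ring
      _ = x * Real.Gamma x := by rw [e]
      _ ≤ _ := by linarith
  · filter_upwards [eventually_gt_atTop 0] with x hx
    have hG := Real.Gamma_pos_of_pos hx
    rw [div_le_one (by positivity), mul_comm]
    exact Gamma_add_le_rpow_mul_Gamma hx hs hs1

theorem tendsto_Gamma_add_div {s : ℝ} (hs : 0 ≤ s) :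
    Tendsto (fun x : ℝ => Real.Gamma (x + s) / (Real.Gamma x * x ^ s)) atTop (𝓝 1) := by
  suffices h : ∀ n : ℕ, Tendsto (fun x : ℝ => Real.Gamma (x + (Int.fract s + n)) /
      (Real.Gamma x * x ^ (Int.fract s + n))) atTop (𝓝 1) by
    have e : Int.fract s + (⌊s⌋₊ : ℝ) = s := by
      rw [natCast_floor_eq_intCast_floor hs, Int.fract_add_floor]
    simpa only [e] using h ⌊s⌋₊
  intro n
  induction n with
  | zero =>
    simpa using tendsto_Gamma_add_div_of_le_one (Int.fract_nonneg s) (Int.fract_lt_one s).le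
  | succ n ih =>
    set t := Int.fract s + n
    have ht : 0 ≤ t := add_nonneg (Int.fract_nonneg s) n.cast_nonneg
    have h1 : Tendsto (fun x : ℝ => 1 + t / x) atTop (𝓝 (1 + 0)) :=
      tendsto_const_nhds.add (tendsto_id.const_div_atTop t)
    have h2 := ih.mul h1
    rw [add_zero, mul_one] at h2
    refine h2.congr' ?_
    filter_upwards [eventually_gt_atTop 0] with x hx
    have hG := Real.Gamma_pos_of_pos hx
    have e : Int.fract s + ((n + 1 : ℕ) : ℝ) = t + 1 := by push_cast; ring
    rw [e, ← add_assoc x t 1, Real.Gamma_add_one (by positivity), Real.rpow_add hx t 1,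
      Real.rpow_one]
    field_simp

theorem tsum_pow_div_poch_eq_besselI {b y : ℝ} (hb : 0 < b) (hy : 0 < y) :
    ∑' n : ℕ, (y ^ 2) ^ n / (poch b n * n.factorial) =
      Real.Gamma b * y ^ (1 - b) * besselI (b - 1) (2 * y) := by
  rw [besselI, ← tsum_mul_left]
  refine tsum_congr fun n => ?_
  have hG := Real.Gamma_pos_of_pos hb
  have hGn : 0 < Real.Gamma (b + n) := Real.Gamma_pos_of_pos (by positivity)
  have e : y ^ (1 - b) * y ^ (b - 1 + 2 * (n : ℝ)) = (y ^ 2) ^ n := by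
    rw [← Real.rpow_add hy, ← pow_mul, ← Real.rpow_natCast]
    push_cast
    ring_nf
  rw [← e, poch, mul_div_cancel_left₀ y two_ne_zero,
    show b - 1 + (n : ℝ) + 1 = b + n by ring]
  field_simp

theorem tendsto_mul_rpow_div_rpow {A B μ : ℝ} (hA : 0 < A) (hB : 0 < B) (hμ : 0 < μ) :
    Tendsto (fun x : ℝ => ((x - 1) * B) ^ x / (betaFn x μ * (B * (x - 1) + A) ^ (x + μ))) atTop
      (𝓝 (B ^ (-μ) * Real.exp (-(A / B)) / Real.Gamma μ)) := by
  have hGμ := Real.Gamma_pos_of_pos hμ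
  have hsub : Tendsto (fun x : ℝ => x - 1) atTop atTop :=
    tendsto_atTop_add_const_right _ _ tendsto_id
  have h1 : Tendsto (fun x : ℝ => (1 + (A / B) / (x - 1)) ^ (x - 1)) atTop
      (𝓝 (Real.exp (A / B))) := (Real.tendsto_one_add_div_rpow_exp (A / B)).comp hsub
  have h2 : Tendsto (fun x : ℝ => 1 + (A / B) / (x - 1)) atTop (𝓝 (1 + 0)) :=
    tendsto_const_nhds.add (hsub.const_div_atTop _)
  have h3 : Tendsto (fun x : ℝ => (B + (A - B) / x) ^ (-μ)) atTop (𝓝 (B ^ (-μ))) := by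
    have : Tendsto (fun x : ℝ => B + (A - B) / x) atTop (𝓝 (B + 0)) :=
      tendsto_const_nhds.add (tendsto_id.const_div_atTop _)
    rw [add_zero] at this
    exact this.rpow_const (Or.inl hB.ne')
  have h := (((tendsto_Gamma_add_div hμ.le).mul h3).mul
    ((h1.mul h2).inv₀ (by simp))).div_const (Real.Gamma μ)
  rw [add_zero, mul_one, one_mul, ← Real.exp_neg] at h
  refine h.congr' ?_
  filter_upwards [eventually_gt_atTop 1] with x hx
  have hx0 : 0 < x := by linarith
  have hx1 : 0 < x - 1 := by linarith
  have hGx := Real.Gamma_pos_of_pos hx0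
  have hGxμ := Real.Gamma_pos_of_pos (add_pos hx0 hμ)
  have hE : 0 < (x - 1) * B := by positivity
  have hD : 0 < B * (x - 1) + A := by positivity
  have e1 : 1 + (A / B) / (x - 1) = (B * (x - 1) + A) / ((x - 1) * B) := by
    field_simp
  have e2 : B + (A - B) / x = (B * (x - 1) + A) / x := by
    field_simp
    ring
  have e3 : (1 + (A / B) / (x - 1)) ^ (x - 1) * (1 + (A / B) / (x - 1)) =
      (B * (x - 1) + A) ^ x / ((x - 1) * B) ^ x := by
    rw [← Real.rpow_add_one (by rw [e1]; positivity), sub_add_cancel, e1,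
      Real.div_rpow hD.le hE.le]
  rw [e3, e2, Real.div_rpow hD.le hx0.le, Real.rpow_neg hD.le, Real.rpow_neg hx0.le, betaFn,
    Real.rpow_add hD]
  have p1 : 0 < (B * (x - 1) + A) ^ x := by positivity
  have p2 : 0 < (B * (x - 1) + A) ^ μ := by positivity
  have p3 : 0 < ((x - 1) * B) ^ x := by positivity
  have p4 : 0 < x ^ μ := by positivity
  generalize (B * (x - 1) + A) ^ x = u1 at *
  generalize (B * (x - 1) + A) ^ μ = u2 at *
  generalize ((x - 1) * B) ^ x = u3 at *
  generalize x ^ μ = u4 at *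
  field_simp

/-- Table IV: the single shadowed κ-μ Type III (inverse Nakagami-m) PDF
converges pointwise to the κ-μ PDF as the multiplicative shadowing
parameter m_t → ∞. -/
theorem single_shadowed_typeIII_limit_kappa_mu
    (κ μ rhat r : ℝ)
    (hκ : 0 < κ) (hμ : 0 < μ) (hrhat : 0 < rhat) (hr : 0 < r) :
    Filter.Tendsto
      (fun mt : ℝ =>
        (2 * (1 + κ) ^ μ * μ ^ μ * Real.exp (-(κ * μ)) *
            ((mt - 1) * rhat ^ 2) ^ mt * r ^ (2 * μ - 1) /
            (betaFn mt μ * (rhat ^ 2 * (mt - 1) + r ^ 2 * (1 + κ) * μ) ^ (mt + μ))) *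
          hyp1F1 (mt + μ) μ
            (μ ^ 2 * κ * (1 + κ) * r ^ 2 /
              (rhat ^ 2 * (mt - 1) + r ^ 2 * (1 + κ) * μ)))
      Filter.atTop
      (nhds (2 * μ * (1 + κ) ^ ((μ + 1) / 2) * r ^ μ * κ ^ (-(μ - 1) / 2) *
        Real.exp (-(κ * μ)) * rhat ^ (-(μ + 1)) *
        Real.exp (-μ * (1 + κ) * r ^ 2 / rhat ^ 2) *
        besselI (μ - 1) (2 * μ * Real.sqrt (κ * (1 + κ)) * r / rhat))) := by
  have hκ1 : 0 < 1 + κ := by linarith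
  set A := r ^ 2 * (1 + κ) * μ with hA
  set B := rhat ^ 2 with hB
  have hA0 : 0 < A := by positivity
  have hB0 : 0 < B := by positivity
  set y := μ * Real.sqrt (κ * (1 + κ)) * r / rhat with hy
  have hy0 : 0 < y := by positivity
  set C := μ ^ 2 * κ * (1 + κ) * r ^ 2 with hC
  have hC0 : 0 < C := by positivity
  have hyC : y ^ 2 = C / B := by
    rw [hy, div_pow, mul_pow, mul_pow, Real.sq_sqrt (by positivity), hC]
    ring
  have hD : Tendsto (fun x : ℝ => B * (x - 1) + A) atTop atTop :=
    tendsto_atTop_add_const_right _ _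
      ((tendsto_atTop_add_const_right _ (-1) tendsto_id).const_mul_atTop hB0)
  have hz0 : Tendsto (fun x : ℝ => C / (B * (x - 1) + A)) atTop (𝓝 0) := hD.const_div_atTop C
  have haz : Tendsto (fun x : ℝ => (x + μ) * (C / (B * (x - 1) + A))) atTop (𝓝 (y ^ 2)) := by
    have h : Tendsto (fun x : ℝ => C / B + ((μ + 1) - A / B) * (C / (B * (x - 1) + A))) atTop
        (𝓝 (C / B + ((μ + 1) - A / B) * 0)) := tendsto_const_nhds.add (hz0.const_mul _)
    rw [mul_zero, add_zero, ← hyC] at h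
    refine h.congr' ?_
    filter_upwards [hD.eventually_gt_atTop 0] with x hx
    rw [hyC]
    field_simp
    ring
  have hF := tendsto_hyp1F1_of_tendsto_mul hμ (tendsto_atTop_add_const_right _ μ tendsto_id)
    ((hD.eventually_gt_atTop 0).mono fun x hx => (div_pos hC0 hx).le) hz0 haz (by positivity)
  rw [tsum_pow_div_poch_eq_besselI hμ hy0] at hF
  have h := ((tendsto_mul_rpow_div_rpow hA0 hB0 hμ).const_mul
    (2 * (1 + κ) ^ μ * μ ^ μ * Real.exp (-(κ * μ)) * r ^ (2 * μ - 1))).mul hF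
  convert h using 2
  · ring_nf
    simp only [id]
  · have hGμ := (Real.Gamma_pos_of_pos hμ).ne'
    have e1 : 2 * μ * Real.sqrt (κ * (1 + κ)) * r / rhat = 2 * y := by rw [hy]; ring
    have e2 : -μ * (1 + κ) * r ^ 2 / B = -(A / B) := by rw [hA]; ring
    have key : μ * (1 + κ) ^ ((μ + 1) / 2) * r ^ μ * κ ^ (-(μ - 1) / 2) * rhat ^ (-(μ + 1)) =
        (1 + κ) ^ μ * μ ^ μ * r ^ (2 * μ - 1) * B ^ (-μ) * y ^ (1 - μ) := by
      refine Real.log_injOn_pos (mem_Ioi.2 (by positivity)) (mem_Ioi.2 (by positivity)) ?_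
      simp (disch := positivity) only [hy, hB, Real.log_mul, Real.log_div, Real.log_rpow,
        Real.log_pow, Real.log_sqrt]
      push_cast
      ring
    rw [e1, e2]
    calc _ = 2 * (μ * (1 + κ) ^ ((μ + 1) / 2) * r ^ μ * κ ^ (-(μ - 1) / 2) * rhat ^ (-(μ + 1))) *
          Real.exp (-(κ * μ)) * Real.exp (-(A / B)) * besselI (μ - 1) (2 * y) := by ring
      _ = _ := by
        rw [key]
        field_simp
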